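/- arXiv:1612.02279 — 4 statements merged into one kernel-verified Lean document; each statement's English description precedes it below -/
import Mathlib

section
/- Let (W, W') be an exchangeable pair of real random variables, let G be a sub-σ-field containing σ(W), and let λ > 0 be such that (1/λ)E[W'−W | G] = −W almost surely. Let g : ℝ → ℝ be absolutely continuous with E[(1 + |W| + |W'|)·|g(W)|] < ∞. Then E[W·g(W)] = E[ g'(W) · (1/(2λ))E[(W'−W)² | G] ] + E, where E := (1/(2λ))·E[ (W'−W)² · ∫₀¹ ( g'(W + t(W'−W)) − g'(W) ) dt ]. -/
open MeasureTheory ProbabilityTheory Real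

lemma aux_integrable {Ω : Type*} {m m0 : MeasurableSpace Ω} (hm : m ≤ m0) (μ : Measure Ω)
    [IsProbabilityMeasure μ] (f X : Ω → ℝ) (hf : StronglyMeasurable[m] f)
    (hX : Integrable X μ) (hX0 : 0 ≤ X) (h : Integrable (fun ω => f ω * (μ[X|m]) ω) μ) :
    Integrable (fun ω => f ω * X ω) μ := by
  have hfm : Measurable[m] f := hf.measurable
  have hfm0 : Measurable f := hfm.mono hm le_rfl
  have hset : ∀ n : ℕ, MeasurableSet[m] {ω | |f ω| ≤ n} := fun n => by
    have h1 : MeasurableSet {x : ℝ | |x| ≤ n} := measurableSet_le (by fun_prop) (by fun_prop)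
    exact hfm h1
  have hcov : AECover μ Filter.atTop (fun n : ℕ => {ω | |f ω| ≤ n}) := by
    refine ⟨Filter.Eventually.of_forall fun ω => ?_, fun n => hm _ (hset n)⟩
    obtain ⟨k, hk⟩ := exists_nat_ge |f ω|
    filter_upwards [Filter.eventually_ge_atTop k] with n hn
    exact hk.trans (by exact_mod_cast hn)
  have hE0 : 0 ≤ᵐ[μ] μ[X|m] := condExp_nonneg (Filter.Eventually.of_forall hX0)
  let F : ℕ → Ω → ℝ := fun n => Set.indicator {ω | |f ω| ≤ n} (fun ω => |f ω|)
  have hFm : ∀ n, StronglyMeasurable[m] (F n) := fun n => by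
    have ha : Measurable[m] (fun ω => |f ω|) := measurable_norm.comp hfm
    exact (ha.indicator (hset n)).stronglyMeasurable
  have hFb : ∀ n ω, ‖F n ω‖ ≤ n := fun n ω => by
    by_cases hw : |f ω| ≤ n <;> simp [F, Set.indicator, hw]
  have hFX : ∀ n, Integrable (F n * X) μ := fun n =>
    hX.bdd_mul ((hFm n).mono hm).aestronglyMeasurable (Filter.Eventually.of_forall (hFb n))
  refine hcov.integrable_of_integral_norm_bounded (∫ ω, ‖f ω * (μ[X|m]) ω‖ ∂μ) (fun n => ?_)
    (Filter.Eventually.of_forall fun n => ?_)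
  · rw [← integrable_indicator_iff (hm _ (hset n))]
    refine (hFX n).mono ?_ (Filter.Eventually.of_forall fun ω => ?_)
    · exact (hfm0.aestronglyMeasurable.mul hX.1).indicator (hm _ (hset n))
    · by_cases hw : |f ω| ≤ n <;> simp [F, Set.indicator, hw]
  · rw [← integral_indicator (hm _ (hset n))]
    have e1 : (Set.indicator {ω | |f ω| ≤ n} (fun ω => ‖f ω * X ω‖)) = F n * X := by
      ext ω
      have := hX0 ω
      by_cases hw : |f ω| ≤ n <;> simp [F, Set.indicator, hw, abs_of_nonneg this]
    rw [e1, ← integral_condExp hm]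
    have e2 := condExp_mul_of_stronglyMeasurable_left (hFm n) (hFX n) hX
    refine integral_mono_ae integrable_condExp h.norm ?_
    filter_upwards [e2, hE0] with ω h1 h2
    rw [h1]
    have h2' : 0 ≤ (μ[X|m]) ω := h2
    have := mul_nonneg (abs_nonneg (f ω)) h2'
    by_cases hw : |f ω| ≤ n <;> simp [F, Set.indicator, hw, abs_of_nonneg h2', abs_mul, this]

lemma aux_main
    {Ω : Type*} {𝒢 m0 : MeasurableSpace Ω} (μ : Measure Ω) [IsProbabilityMeasure μ]
    (W W' : Ω → ℝ) (hW : Measurable W) (hW' : Measurable W')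
    (hexch : μ.map (fun ω => (W ω, W' ω)) = μ.map (fun ω => (W' ω, W ω)))
    (h𝒢 : 𝒢 ≤ m0)
    (hσW : MeasurableSpace.comap W inferInstance ≤ 𝒢)
    (lam : ℝ) (hlam : 0 < lam)
    (hreg : ∀ᵐ ω ∂μ, (1 / lam) * (μ[fun ω => W' ω - W ω|𝒢]) ω = -W ω)
    (hsq : Integrable (fun ω => (W' ω - W ω) ^ 2) μ)
    (g g' : ℝ → ℝ) (hg'meas : Measurable g')
    (hg'loc : LocallyIntegrable g' volume)
    (hFTC : ∀ x y : ℝ, g y = g x + ∫ t in x..y, g' t)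
    (hgW : Integrable (fun ω => (1 + |W ω| + |W' ω|) * |g (W ω)|) μ)
    (hmain : Integrable
      (fun ω => g' (W ω) * ((1 / (2 * lam)) * (μ[fun ω => (W' ω - W ω) ^ 2|𝒢]) ω)) μ)
    (hrem : Integrable
      (fun ω => (W' ω - W ω) ^ 2 *
        ∫ t in (0:ℝ)..1, (g' (W ω + t * (W' ω - W ω)) - g' (W ω))) μ) :
    (∫ ω, W ω * g (W ω) ∂μ)
      = (∫ ω, g' (W ω) * ((1 / (2 * lam)) * (μ[fun ω => (W' ω - W ω) ^ 2|𝒢]) ω) ∂μ)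
        + (1 / (2 * lam)) *
            ∫ ω, ((W' ω - W ω) ^ 2 *
              ∫ t in (0:ℝ)..1, (g' (W ω + t * (W' ω - W ω)) - g' (W ω))) ∂μ := by
  set D : Ω → ℝ := fun ω => W' ω - W ω with hD
  have hDm : Measurable D := hW'.sub hW
  have hii : ∀ a b : ℝ, IntervalIntegrable g' volume a b := fun a b =>
    (hg'loc.integrableOn_isCompact isCompact_uIcc).intervalIntegrable
  have hgc : Continuous g := by
    have : g = fun y => g 0 + ∫ t in (0:ℝ)..y, g' t := funext fun y => hFTC 0 y
    rw [this]
    exact continuous_const.add (intervalIntegral.continuous_primitive hii 0)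
  have hgm : Measurable g := hgc.measurable
  have hWG : Measurable[𝒢] W := fun s hs => hσW _ ⟨s, hs, rfl⟩
  have hDi : Integrable D μ :=
    ((memLp_two_iff_integrable_sq hDm.aestronglyMeasurable).2 hsq).integrable one_le_two
  -- pointwise identity
  have hpt : ∀ ω, D ω ^ 2 * ∫ t in (0:ℝ)..1, (g' (W ω + t * D ω) - g' (W ω))
      = D ω * (g (W' ω) - g (W ω)) - g' (W ω) * D ω ^ 2 := by
    intro ω
    by_cases h0 : D ω = 0
    · simp [h0]
    have hI : IntervalIntegrable (fun t => g' (W ω + t * D ω)) volume 0 1 := by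
      have h1 := ((hii (W ω) (W' ω)).comp_add_left (W ω)).comp_mul_right (c := D ω)
      have h3 : W' ω - W ω = D ω := rfl
      simpa [h3, h0] using h1
    rw [intervalIntegral.integral_sub hI intervalIntegrable_const]
    have h2 : D ω * ∫ t in (0:ℝ)..1, g' (W ω + t * D ω) = g (W' ω) - g (W ω) := by
      have := intervalIntegral.mul_integral_comp_add_mul (a := 0) (b := 1) (f := g') (c := D ω) (d := W ω)
      simp only [mul_comm _ (D ω)]
      rw [this, hFTC (W ω) (W' ω)]
      simp [hD]
    rw [← h2]
    simp
    ring
  have hgWm : StronglyMeasurable[𝒢] (fun ω => g (W ω)) := (hgm.comp hWG).stronglyMeasurable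
  have hA : Integrable (fun ω => g (W ω) * D ω) μ := by
    refine hgW.mono ((hgm.comp hW).mul hDm).aestronglyMeasurable
      (Filter.Eventually.of_forall fun ω => ?_)
    rw [Real.norm_eq_abs, Real.norm_eq_abs, abs_mul, abs_mul, abs_abs, mul_comm]
    refine mul_le_mul_of_nonneg_right ?_ (abs_nonneg _)
    rw [abs_of_nonneg (by positivity : 0 ≤ 1 + |W ω| + |W' ω|)]
    have := abs_sub (W' ω) (W ω)
    linarith
  let H : ℝ × ℝ → ℝ := fun p => g p.1 * (p.2 - p.1)
  have hHm : Measurable H := by fun_prop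
  have hp1 : Measurable (fun ω => (W ω, W' ω)) := hW.prodMk hW'
  have hp2 : Measurable (fun ω => (W' ω, W ω)) := hW'.prodMk hW
  have hB : Integrable (fun ω => g (W' ω) * (W ω - W' ω)) μ := by
    have h1 : Integrable H (μ.map (fun ω => (W ω, W' ω))) :=
      (integrable_map_measure hHm.aestronglyMeasurable hp1.aemeasurable).2 hA
    rw [hexch] at h1
    exact (integrable_map_measure hHm.aestronglyMeasurable hp2.aemeasurable).1 h1
  have hAB : ∫ ω, g (W ω) * D ω ∂μ = ∫ ω, g (W' ω) * (W ω - W' ω) ∂μ := by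
    have h1 := integral_map hp1.aemeasurable
      (hHm.aestronglyMeasurable (μ := μ.map (fun ω => (W ω, W' ω))))
    have h2 := integral_map hp2.aemeasurable
      (hHm.aestronglyMeasurable (μ := μ.map (fun ω => (W' ω, W ω))))
    rw [hexch, h2] at h1
    exact h1.symm
  have hl : lam ≠ 0 := hlam.ne'
  have hAc : ∫ ω, g (W ω) * D ω ∂μ = -lam * ∫ ω, W ω * g (W ω) ∂μ := by
    rw [← integral_condExp h𝒢, ← integral_const_mul]
    refine integral_congr_ae ?_
    filter_upwards [condExp_mul_of_stronglyMeasurable_left hgWm hA hDi, hreg] with ω h1 h2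
    have h3 : (μ[D|𝒢]) ω = -lam * W ω := by
      field_simp at h2
      linarith
    refine h1.trans ?_
    simp only [Pi.mul_apply, h3]
    ring
  have hg'W : StronglyMeasurable[𝒢] (fun ω => g' (W ω)) := (hg'meas.comp hWG).stronglyMeasurable
  have hmain2 : Integrable (fun ω => g' (W ω) * (μ[fun ω => D ω ^ 2|𝒢]) ω) μ := by
    refine (hmain.const_mul (2 * lam)).congr (Filter.Eventually.of_forall fun ω => ?_)
    simp only [hD]
    field_simp
  have hC : Integrable (fun ω => g' (W ω) * D ω ^ 2) μ :=
    aux_integrable h𝒢 μ _ (fun ω => D ω ^ 2) hg'W hsq (fun ω => sq_nonneg _) hmain2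
  have hCc : ∫ ω, g' (W ω) * ((1 / (2 * lam)) * (μ[fun ω => D ω ^ 2|𝒢]) ω) ∂μ
      = (1 / (2 * lam)) * ∫ ω, g' (W ω) * D ω ^ 2 ∂μ := by
    rw [← integral_condExp h𝒢 (f := fun ω => g' (W ω) * D ω ^ 2), ← integral_const_mul]
    refine integral_congr_ae ?_
    filter_upwards [condExp_mul_of_stronglyMeasurable_left hg'W hC hsq] with ω h1
    have h1' : (μ[fun ω => g' (W ω) * D ω ^ 2|𝒢]) ω
      = g' (W ω) * (μ[fun ω => D ω ^ 2|𝒢]) ω := h1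
    rw [h1']
    ring
  have hR : ∫ ω, (D ω ^ 2 * ∫ t in (0:ℝ)..1, (g' (W ω + t * D ω) - g' (W ω))) ∂μ
      = 2 * lam * (∫ ω, W ω * g (W ω) ∂μ) - ∫ ω, g' (W ω) * D ω ^ 2 ∂μ := by
    have e : ∀ ω, D ω ^ 2 * ∫ t in (0:ℝ)..1, (g' (W ω + t * D ω) - g' (W ω))
      = (-(g (W' ω) * (W ω - W' ω)) - g (W ω) * D ω) - g' (W ω) * D ω ^ 2 := fun ω => by
      rw [hpt]
      simp only [hD]
      ring
    simp_rw [e]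
    have hB' : Integrable (fun ω => -(g (W' ω) * (W ω - W' ω))) μ := hB.neg
    have hBA : Integrable (fun ω => -(g (W' ω) * (W ω - W' ω)) - g (W ω) * D ω) μ := hB'.sub hA
    rw [integral_sub hBA hC, integral_sub hB' hA, integral_neg, ← hAB, hAc]
    ring
  change _ = (∫ ω, g' (W ω) * ((1 / (2 * lam)) * (μ[fun ω => D ω ^ 2|𝒢]) ω) ∂μ) +
    (1 / (2 * lam)) * ∫ ω, (D ω ^ 2 * ∫ t in (0:ℝ)..1, (g' (W ω + t * D ω) - g' (W ω))) ∂μ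
  rw [hCc, hR]
  field_simp
  ring

lemma aux_degen
    {Ω : Type*} {𝒢 m0 : MeasurableSpace Ω} (μ : Measure Ω) [IsProbabilityMeasure μ]
    (W W' : Ω → ℝ) (hW : Measurable W) (hW' : Measurable W')
    (hexch : μ.map (fun ω => (W ω, W' ω)) = μ.map (fun ω => (W' ω, W ω)))
    (hle : ¬ 𝒢 ≤ m0)
    (hσW : MeasurableSpace.comap W inferInstance ≤ 𝒢)
    (lam : ℝ) (hlam : 0 < lam)
    (hreg : ∀ᵐ ω ∂μ, (1 / lam) * (μ[fun ω => W' ω - W ω|𝒢]) ω = -W ω)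
    (hsq : Integrable (fun ω => (W' ω - W ω) ^ 2) μ)
    (g g' : ℝ → ℝ) (hg'meas : Measurable g')
    (hg'loc : LocallyIntegrable g' volume)
    (hFTC : ∀ x y : ℝ, g y = g x + ∫ t in x..y, g' t)
    (hgW : Integrable (fun ω => (1 + |W ω| + |W' ω|) * |g (W ω)|) μ)
    (hmain : Integrable
      (fun ω => g' (W ω) * ((1 / (2 * lam)) * (μ[fun ω => (W' ω - W ω) ^ 2|𝒢]) ω)) μ)
    (hrem : Integrable
      (fun ω => (W' ω - W ω) ^ 2 *
        ∫ t in (0:ℝ)..1, (g' (W ω + t * (W' ω - W ω)) - g' (W ω))) μ) :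
    (∫ ω, W ω * g (W ω) ∂μ)
      = (∫ ω, g' (W ω) * ((1 / (2 * lam)) * (μ[fun ω => (W' ω - W ω) ^ 2|𝒢]) ω) ∂μ)
        + (1 / (2 * lam)) *
            ∫ ω, ((W' ω - W ω) ^ 2 *
              ∫ t in (0:ℝ)..1, (g' (W ω + t * (W' ω - W ω)) - g' (W ω))) ∂μ := by
  -- the conditional expectations vanish, so `W = W' = 0` almost surely
  simp only [condExp_of_not_le hle] at hreg ⊢
  have hW0 : ∀ᵐ ω ∂μ, W ω = 0 := by
    filter_upwards [hreg] with ω h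
    simpa using h.symm
  have hms : MeasurableSet {p : ℝ × ℝ | p.1 = 0} := measurableSet_eq_fun measurable_fst measurable_const
  have h1 : ∀ᵐ p ∂(μ.map (fun ω => (W ω, W' ω))), p.1 = 0 :=
    (ae_map_iff (hW.prodMk hW').aemeasurable hms).2 hW0
  rw [hexch] at h1
  have hW0' : ∀ᵐ ω ∂μ, W' ω = 0 :=
    (ae_map_iff (hW'.prodMk hW).aemeasurable hms).1 h1
  have e1 : ∫ ω, W ω * g (W ω) ∂μ = 0 := integral_eq_zero_of_ae (by
    filter_upwards [hW0] with ω h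
    simp [h])
  have e2 : ∫ ω, ((W' ω - W ω) ^ 2 *
      ∫ t in (0:ℝ)..1, (g' (W ω + t * (W' ω - W ω)) - g' (W ω))) ∂μ = 0 :=
    integral_eq_zero_of_ae (by
      filter_upwards [hW0, hW0'] with ω h h'
      simp [h, h'])
  rw [e1, e2]
  simp

/-- Lemma `exlemma1`: let `(W, W')` be an exchangeable pair on a probability
space, `𝒢 ⊇ σ(W)` a sub-σ-field, and `λ > 0` with `(1/λ) E[W' − W | 𝒢] = −W` a.s.  Let `g` be
absolutely continuous with a.e. derivative `g'` (formalized via the fundamental theorem of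
calculus: `g y = g x + ∫_x^y g'`, with `g'` measurable and locally integrable) and
`E[(1 + |W| + |W'|) |g(W)|] < ∞`.  Then, all expectations involved being assumed finite,
`E[W g(W)] = E[g'(W) · (1/(2λ)) E[(W'−W)² | 𝒢]] + E`, where
`E = (1/(2λ)) E[(W'−W)² ∫₀¹ (g'(W + t(W'−W)) − g'(W)) dt]`. -/
theorem exchangeable_pair_identity
    {Ω : Type*} [MeasurableSpace Ω] (μ : Measure Ω) [IsProbabilityMeasure μ]
    (W W' : Ω → ℝ) (hW : Measurable W) (hW' : Measurable W')
    (hexch : μ.map (fun ω => (W ω, W' ω)) = μ.map (fun ω => (W' ω, W ω)))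
    (𝒢 : MeasurableSpace Ω) (h𝒢 : 𝒢 ≤ ‹MeasurableSpace Ω›)
    (hσW : MeasurableSpace.comap W inferInstance ≤ 𝒢)
    (lam : ℝ) (hlam : 0 < lam)
    (hreg : ∀ᵐ ω ∂μ, (1 / lam) * (μ[fun ω => W' ω - W ω|𝒢]) ω = -W ω)
    (hsq : Integrable (fun ω => (W' ω - W ω) ^ 2) μ)
    (g g' : ℝ → ℝ) (hg'meas : Measurable g')
    (hg'loc : LocallyIntegrable g' volume)
    (hFTC : ∀ x y : ℝ, g y = g x + ∫ t in x..y, g' t)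
    (hgW : Integrable (fun ω => (1 + |W ω| + |W' ω|) * |g (W ω)|) μ)
    (hmain : Integrable
      (fun ω => g' (W ω) * ((1 / (2 * lam)) * (μ[fun ω => (W' ω - W ω) ^ 2|𝒢]) ω)) μ)
    (hrem : Integrable
      (fun ω => (W' ω - W ω) ^ 2 *
        ∫ t in (0:ℝ)..1, (g' (W ω + t * (W' ω - W ω)) - g' (W ω))) μ) :
    (∫ ω, W ω * g (W ω) ∂μ)
      = (∫ ω, g' (W ω) * ((1 / (2 * lam)) * (μ[fun ω => (W' ω - W ω) ^ 2|𝒢]) ω) ∂μ)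
        + (1 / (2 * lam)) *
            ∫ ω, ((W' ω - W ω) ^ 2 *
              ∫ t in (0:ℝ)..1, (g' (W ω + t * (W' ω - W ω)) - g' (W ω))) ∂μ := by
  rename_i m0 _
  by_cases hle : 𝒢 ≤ m0
  · exact aux_main μ W W' hW hW' hexch hle hσW lam hlam hreg hsq g g' hg'meas hg'loc hFTC hgW
      hmain hrem
  · exact aux_degen μ W W' hW hW' hexch hle hσW lam hlam hreg hsq g g' hg'meas hg'loc hFTC hgW
      hmain hrem
end

section
/- Let X and Y be real-valued random variables with E|X| < ∞ and E|Y| < ∞, and suppose d₂(X, Y) ≤ 1. Then d₁(X, Y) ≤ (4/√π)·√(d₂(X, Y)). -/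
open MeasureTheory ProbabilityTheory Real

/-- The class `H₂` of test functions: differentiable `h` with `‖h^{(1)}‖ ≤ 1` (i.e. `h` is
1-Lipschitz) and `h'` Lipschitz with `‖h^{(2)}‖ ≤ 1` (i.e. `h'` is 1-Lipschitz). -/
def MemH2 (h : ℝ → ℝ) : Prop :=
  Differentiable ℝ h ∧ LipschitzWith 1 h ∧ LipschitzWith 1 (deriv h)

/-- The distance `d₂` between two laws on `ℝ`, induced by the class `H₂`. -/
noncomputable def d2Dist (μ ν : Measure ℝ) : ℝ :=
  sSup {c | ∃ h : ℝ → ℝ, MemH2 h ∧ c = |(∫ x, h x ∂μ) - ∫ x, h x ∂ν|}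

/-- The 1-Wasserstein distance `d₁` between two laws on `ℝ`, induced by the class `H₁` of
1-Lipschitz test functions. -/
noncomputable def d1Dist (μ ν : Measure ℝ) : ℝ :=
  sSup {c | ∃ h : ℝ → ℝ, LipschitzWith 1 h ∧ c = |(∫ x, h x ∂μ) - ∫ x, h x ∂ν|}

lemma aux_smooth (h : ℝ → ℝ) (hh : LipschitzWith 1 h) (ε : ℝ) (h0 : 0 < ε) (h1 : ε ≤ 1) :
    ∃ g : ℝ → ℝ, MemH2 g ∧ ∀ x, |g x - ε * h x| ≤ ε ^ 2 / 2 := by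
  have hL : ∀ x y, |h x - h y| ≤ |x - y| := fun x y => by
    simpa [Real.dist_eq] using hh.dist_le_mul x y
  have hF : ∀ x, HasDerivAt (fun x => ∫ t in (0:ℝ)..x, h t) (h x) x := fun x =>
    (hh.continuous.integral_hasStrictDerivAt 0 x).hasDerivAt
  generalize (fun x => ∫ t in (0:ℝ)..x, h t) = F at hF
  have hg : ∀ x, HasDerivAt (fun x => (F (x + ε) - F (x - ε)) / 2)
      ((h (x + ε) - h (x - ε)) / 2) x := fun x =>
    (((hF (x + ε)).comp_add_const x ε).sub ((hF (x - ε)).comp_sub_const x ε)).div_const 2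
  refine ⟨fun x => (F (x + ε) - F (x - ε)) / 2, ⟨fun x => (hg x).differentiableAt, ?_, ?_⟩, ?_⟩
  · apply lipschitzWith_of_nnnorm_deriv_le (fun x => (hg x).differentiableAt)
    intro x
    rw [(hg x).deriv, ← NNReal.coe_le_coe, coe_nnnorm, Real.norm_eq_abs, abs_div]
    have := hL (x + ε) (x - ε)
    have e : x + ε - (x - ε) = 2 * ε := by ring
    rw [e, abs_of_pos (by positivity : 0 < 2 * ε)] at this
    rw [abs_of_pos (by norm_num : (0:ℝ) < 2)]
    simp only [NNReal.coe_one]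
    linarith
  · apply LipschitzWith.of_dist_le_mul
    intro x y
    rw [(hg x).deriv, (hg y).deriv, Real.dist_eq, Real.dist_eq]
    have a1 := hL (x + ε) (y + ε)
    have a2 := hL (x - ε) (y - ε)
    rw [add_sub_add_right_eq_sub] at a1
    rw [sub_sub_sub_cancel_right] at a2
    simp only [NNReal.coe_one, one_mul]
    rw [abs_le] at *
    constructor <;> linarith [a1.1, a1.2, a2.1, a2.2]
  · intro x
    have hφ : ∀ s, HasDerivAt (fun s => F (x + s) - F (x - s) - 2 * s * h x)
        (h (x + s) - -h (x - s) - 2 * 1 * h x) s := fun s =>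
      (((hF (x + s)).comp_const_add x s).sub ((hF (x - s)).comp_const_sub x s)).sub
        (((hasDerivAt_id s).const_mul 2).mul_const (h x))
    have hB : ∀ s : ℝ, HasDerivAt (fun s : ℝ => s ^ 2) (2 * s) s := fun s => by
      simpa using hasDerivAt_pow 2 s
    have key := image_norm_le_of_norm_deriv_right_le_deriv_boundary
      (a := 0) (b := ε) (f := fun s => F (x + s) - F (x - s) - 2 * s * h x)
      (f' := fun s => h (x + s) - -h (x - s) - 2 * 1 * h x)
      (B := fun s => s ^ 2) (B' := fun s => 2 * s)
      (fun s _ => (hφ s).continuousAt.continuousWithinAt)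
      (fun s _ => (hφ s).hasDerivWithinAt) (by simp) hB
      (by
        intro s hs
        have a1 := hL (x + s) x
        have a2 := hL (x - s) x
        rw [show x + s - x = s by ring, abs_of_nonneg hs.1] at a1
        rw [show x - s - x = -s by ring, abs_neg, abs_of_nonneg hs.1] at a2
        rw [Real.norm_eq_abs]
        rw [abs_le] at *
        constructor <;> linarith [a1.1, a1.2, a2.1, a2.2])
      (Set.right_mem_Icc.2 h0.le)
    simp only [Real.norm_eq_abs] at key
    rw [abs_le] at *
    constructor <;> linarith [key.1, key.2]

theorem wasserstein_le_sqrt_d2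
    {Ω : Type*} [MeasurableSpace Ω] (μ : Measure Ω) [IsProbabilityMeasure μ]
    (X Y : Ω → ℝ) (hX : Measurable X) (hY : Measurable Y)
    (hXint : Integrable X μ) (hYint : Integrable Y μ)
    (hd2 : d2Dist (μ.map X) (μ.map Y) ≤ 1) :
    d1Dist (μ.map X) (μ.map Y)
      ≤ (4 / Real.sqrt Real.pi) * Real.sqrt (d2Dist (μ.map X) (μ.map Y)) := by
  have hmap : ∀ (Z : Ω → ℝ), Measurable Z → ∀ h : ℝ → ℝ, LipschitzWith 1 h →
      ∫ x, h x ∂(μ.map Z) = ∫ ω, h (Z ω) ∂μ := fun Z hZ h hh =>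
    integral_map hZ.aemeasurable hh.continuous.aestronglyMeasurable
  have hint : ∀ (Z : Ω → ℝ), Measurable Z → Integrable Z μ → ∀ h : ℝ → ℝ, LipschitzWith 1 h →
      Integrable (fun ω => h (Z ω)) μ := fun Z hZ hZi h hh => by
    refine Integrable.mono' (hZi.abs.add (integrable_const |h 0|))
      (hh.continuous.measurable.comp hZ).aestronglyMeasurable (Filter.Eventually.of_forall ?_)
    intro ω
    have := hh.dist_le_mul (Z ω) 0
    simp only [Real.dist_eq, NNReal.coe_one, one_mul, sub_zero] at this
    have h2 := abs_sub_abs_le_abs_sub (h (Z ω)) (h 0)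
    simp only [Real.norm_eq_abs, Pi.add_apply]
    linarith
  have hbdd : BddAbove {c | ∃ h : ℝ → ℝ, MemH2 h ∧
      c = |(∫ x, h x ∂(μ.map X)) - ∫ x, h x ∂(μ.map Y)|} := by
    refine ⟨∫ ω, |X ω - Y ω| ∂μ, ?_⟩
    rintro c ⟨h, ⟨-, hh, -⟩, rfl⟩
    rw [hmap X hX h hh, hmap Y hY h hh, ← integral_sub (hint X hX hXint h hh) (hint Y hY hYint h hh)]
    refine (abs_integral_le_integral_abs).trans (integral_mono
      ((hint X hX hXint h hh).sub (hint Y hY hYint h hh)).abs (hXint.sub hYint).abs ?_)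
    intro ω
    simpa [Real.dist_eq] using hh.dist_le_mul (X ω) (Y ω)
  have hle : ∀ g, MemH2 g → |(∫ x, g x ∂(μ.map X)) - ∫ x, g x ∂(μ.map Y)|
      ≤ d2Dist (μ.map X) (μ.map Y) := fun g hg => le_csSup hbdd ⟨g, hg, rfl⟩
  have hnn : 0 ≤ d2Dist (μ.map X) (μ.map Y) := by
    apply Real.sSup_nonneg
    rintro c ⟨h, -, rfl⟩
    exact abs_nonneg _
  generalize d2Dist (μ.map X) (μ.map Y) = d at *
  have hpi : 2 ≤ 4 / √π := by
    rw [le_div_iff₀ (by positivity)]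
    have : √π ≤ 2 := by
      rw [Real.sqrt_le_left (by norm_num)]
      linarith [Real.pi_le_four]
    linarith
  apply Real.sSup_le
  swap
  · positivity
  rintro c ⟨h, hh, rfl⟩
  have main : ∀ ε : ℝ, 0 < ε → ε ≤ 1 →
      ε * |(∫ x, h x ∂(μ.map X)) - ∫ x, h x ∂(μ.map Y)| ≤ d + ε ^ 2 := by
    intro ε h0 h1
    obtain ⟨g, hg, hgh⟩ := aux_smooth h hh ε h0 h1
    have hclose : ∀ (Z : Ω → ℝ), Measurable Z → Integrable Z μ →
        |(∫ x, g x ∂(μ.map Z)) - ε * ∫ x, h x ∂(μ.map Z)| ≤ ε ^ 2 / 2 := by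
      intro Z hZ hZi
      rw [hmap Z hZ g hg.2.1, hmap Z hZ h hh, ← integral_const_mul,
        ← integral_sub (hint Z hZ hZi g hg.2.1) ((hint Z hZ hZi h hh).const_mul ε)]
      have := norm_integral_le_of_norm_le_const (μ := μ)
        (f := fun ω => g (Z ω) - ε * h (Z ω)) (C := ε ^ 2 / 2)
        (Filter.Eventually.of_forall fun ω => hgh (Z ω))
      simpa using this
    have c1 := hclose X hX hXint
    have c2 := hclose Y hY hYint
    have c3 := hle g hg
    rw [← abs_of_pos h0, ← abs_mul, abs_of_pos h0, mul_sub]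
    rw [abs_le] at *
    constructor <;> linarith [c1.1, c1.2, c2.1, c2.2, c3.1, c3.2]
  generalize |(∫ x, h x ∂(μ.map X)) - ∫ x, h x ∂(μ.map Y)| = D at *
  have hD : D ≤ 2 * √d := by
    rcases hnn.eq_or_lt with h0 | h0
    · subst h0
      simp only [Real.sqrt_zero, mul_zero]
      by_contra! hc
      have h3 := main (min 1 (D / 2)) (by positivity) (min_le_left _ _)
      have h4 : 0 < min 1 (D / 2) := by positivity
      have h5 : min 1 (D / 2) ≤ D / 2 := min_le_right _ _
      nlinarith
    · have hs : 0 < √d := Real.sqrt_pos.2 h0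
      have h3 := main (√d) hs (by rw [Real.sqrt_le_left (by norm_num)]; linarith)
      have h4 := Real.sq_sqrt hnn
      nlinarith
  exact hD.trans (mul_le_mul_of_nonneg_right hpi (Real.sqrt_nonneg _))
end

section
/- Fix ρ > 0, let h : ℝ → ℝ be Lipschitz-continuous with minimum Lipschitz constant ‖h'‖, and let h_ρ := h ∗ k_ρ where k_ρ(x) = (ρ/√(2π))e^{−x²ρ²/2}. Then for each integer m ≥ 1, sup_{x∈ℝ}|h_ρ^{(m)}(x)| ≤ ‖h'‖·∫_ℝ |k_ρ^{(m−1)}(y)| dy ≤ C_m·ρ^{m−1}·‖h'‖, where C_m := ∫_ℝ |H_{m−1}(x)|·φ(x) dx, φ is the standard normal density and H_j is the j-th monic (probabilists') Hermite polynomial. In particular C_1 = 1 and C_2 = √(2/π), and C_m² ≤ (m−1)! for every m ≥ 3. -/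
open MeasureTheory Real

/-- The minimum Lipschitz constant `‖g'‖ = sup_{x ≠ y} |g x - g y| / |x - y|` of `g : ℝ → ℝ`. -/
noncomputable def lipConst (g : ℝ → ℝ) : ℝ :=
  sSup {c | ∃ x y : ℝ, x ≠ y ∧ c = |g x - g y| / |x - y|}

theorem aux_bound (p : Polynomial ℝ) (b : ℝ) (hb : 0 < b) :
    ∃ M : ℝ, 0 ≤ M ∧ ∀ u : ℝ, |p.eval u| * Real.exp (-b * u ^ 2) ≤ M := by
  induction p using Polynomial.induction_on' with
  | add p q hp hq =>
    obtain ⟨M, hM, h1⟩ := hp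
    obtain ⟨N, hN, h2⟩ := hq
    refine ⟨M + N, by positivity, fun u => ?_⟩
    rw [Polynomial.eval_add]
    have := abs_add_le (p.eval u) (q.eval u)
    have he := Real.exp_pos (-b * u ^ 2)
    nlinarith [h1 u, h2 u]
  | monomial n a =>
    refine ⟨|a| * (n.factorial * Real.exp (1 / (4 * b))), by positivity, fun u => ?_⟩
    rw [Polynomial.eval_monomial, abs_mul, mul_assoc, abs_pow]
    refine mul_le_mul_of_nonneg_left ?_ (abs_nonneg a)
    have h1 := Real.pow_div_factorial_le_exp |u| (abs_nonneg u) n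
    rw [div_le_iff₀ (by positivity)] at h1
    have h2 : |u| + -b * u ^ 2 ≤ 1 / (4 * b) := by
      rw [le_div_iff₀ (by positivity), ← sq_abs u]
      nlinarith [sq_nonneg (2 * b * |u| - 1)]
    calc |u| ^ n * Real.exp (-b * u ^ 2)
        ≤ Real.exp |u| * n.factorial * Real.exp (-b * u ^ 2) := by gcongr
      _ = n.factorial * Real.exp (|u| + -b * u ^ 2) := by rw [Real.exp_add]; ring
      _ ≤ _ := by gcongr

theorem aux_bound2 (p : Polynomial ℝ) (b : ℝ) (hb : 0 < b) :
    ∃ M : ℝ, 0 ≤ M ∧ ∀ u : ℝ, |p.eval u| * Real.exp (-b * u ^ 2)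
      ≤ M * Real.exp (-(b / 2) * u ^ 2) := by
  obtain ⟨M, hM, h1⟩ := aux_bound p (b / 2) (by positivity)
  refine ⟨M, hM, fun u => ?_⟩
  have : Real.exp (-b * u ^ 2) = Real.exp (-(b / 2) * u ^ 2) * Real.exp (-(b / 2) * u ^ 2) := by
    rw [← Real.exp_add]; congr 1; ring
  rw [this, ← mul_assoc]
  exact mul_le_mul_of_nonneg_right (h1 u) (Real.exp_pos _).le

theorem aux_int (p : Polynomial ℝ) (b : ℝ) (hb : 0 < b) :
    Integrable (fun u : ℝ => p.eval u * Real.exp (-b * u ^ 2)) := by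
  obtain ⟨M, hM, h1⟩ := aux_bound2 p b hb
  refine ((integrable_exp_neg_mul_sq (half_pos hb)).const_mul M).mono' ?_ ?_
  · exact (by fun_prop : Continuous _).aestronglyMeasurable
  · refine Filter.Eventually.of_forall fun u => ?_
    rw [Real.norm_eq_abs, abs_mul, abs_of_pos (Real.exp_pos _)]
    exact h1 u

theorem aux_deriv (p : Polynomial ℝ) (b : ℝ) (u : ℝ) :
    HasDerivAt (fun u : ℝ => p.eval u * Real.exp (-b * u ^ 2))
      ((p.derivative - Polynomial.C (2 * b) * Polynomial.X * p).eval u *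
        Real.exp (-b * u ^ 2)) u := by
  have h1 := p.hasDerivAt u
  have h2 : HasDerivAt (fun u : ℝ => Real.exp (-b * u ^ 2))
      (Real.exp (-b * u ^ 2) * (-b * (2 * u))) u := by
    have := ((hasDerivAt_pow 2 u).const_mul (-b)).exp
    simpa using this
  refine (h1.mul h2).congr_deriv ?_
  simp only [Polynomial.eval_sub, Polynomial.eval_mul, Polynomial.eval_C, Polynomial.eval_X]
  ring

/-- The convolution is differentiable. -/
theorem aux_conv (h : ℝ → ℝ) (K : NNReal) (hL : LipschitzWith K h) (p : Polynomial ℝ)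
    (b : ℝ) (hb : 0 < b) (x₀ : ℝ) :
    HasDerivAt (fun x => ∫ y, h y * (p.eval (x - y) * Real.exp (-b * (x - y) ^ 2)))
      (∫ y, h y * ((p.derivative - Polynomial.C (2 * b) * Polynomial.X * p).eval (x₀ - y) *
        Real.exp (-b * (x₀ - y) ^ 2))) x₀ := by
  have hc := hL.continuous
  -- general domination
  have key : ∀ q : Polynomial ℝ, ∃ bound : ℝ → ℝ, Integrable bound ∧
      ∀ y, ∀ x ∈ Metric.ball x₀ 1,
        ‖h y * (q.eval (x - y) * Real.exp (-b * (x - y) ^ 2))‖ ≤ bound y := by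
    intro q
    obtain ⟨M, hM, h1⟩ := aux_bound2 q b hb
    refine ⟨fun y => (fun t => (|h x₀| + K * |t|) * (M * (Real.exp (b / 2) *
      Real.exp (-(b / 4) * t ^ 2)))) (y - x₀), ?_, ?_⟩
    · refine Integrable.comp_sub_right (f := fun t => (|h x₀| + K * |t|) * (M * (Real.exp (b / 2) *
        Real.exp (-(b / 4) * t ^ 2)))) ?_ x₀
      have i1 := (integrable_exp_neg_mul_sq (b := b / 4) (by positivity)).const_mul
        (|h x₀| * M * Real.exp (b / 2))
      have i2 := ((aux_int Polynomial.X (b / 4) (by positivity)).norm).const_mul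
        (K * M * Real.exp (b / 2))
      refine (i1.add i2).congr (Filter.Eventually.of_forall fun t => ?_)
      simp [abs_of_pos (Real.exp_pos _)]
      ring
    · intro y x hx
      rw [Metric.mem_ball, Real.dist_eq] at hx
      rw [norm_mul, norm_mul, Real.norm_eq_abs, Real.norm_eq_abs, Real.norm_eq_abs,
        abs_of_pos (Real.exp_pos _)]
      have hh : |h y| ≤ |h x₀| + K * |y - x₀| := by
        have := hL.dist_le_mul y x₀
        rw [Real.dist_eq, Real.dist_eq] at this
        have h3 := abs_sub_abs_le_abs_sub (h y) (h x₀)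
        linarith
      refine mul_le_mul hh ((h1 _).trans ?_) (by positivity) (by positivity)
      refine mul_le_mul_of_nonneg_left ?_ hM
      rw [← Real.exp_add]
      apply Real.exp_le_exp.mpr
      have h4 : (x - x₀) ^ 2 ≤ 1 := by
        rw [← sq_abs]; nlinarith [abs_nonneg (x - x₀)]
      have h5 : (y - x₀) ^ 2 ≤ 2 * (x - y) ^ 2 + 2 * (x - x₀) ^ 2 := by
        nlinarith [sq_nonneg ((x - y) + (x - x₀))]
      nlinarith
  obtain ⟨B, hB, hB1⟩ := key (p.derivative - Polynomial.C (2 * b) * Polynomial.X * p)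
  obtain ⟨B', hB', hB1'⟩ := key p
  have meas : ∀ (q : Polynomial ℝ) (x : ℝ), AEStronglyMeasurable
      (fun y => h y * (q.eval (x - y) * Real.exp (-b * (x - y) ^ 2))) := by
    intro q x
    exact (by fun_prop : Continuous _).aestronglyMeasurable
  refine (hasDerivAt_integral_of_dominated_loc_of_deriv_le (bound := B)
    (F := fun x y => h y * (p.eval (x - y) * Real.exp (-b * (x - y) ^ 2)))
    (F' := fun x y => h y * ((p.derivative - Polynomial.C (2 * b) * Polynomial.X * p).eval (x - y) *
        Real.exp (-b * (x - y) ^ 2)))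
    (Metric.ball_mem_nhds x₀ one_pos) (Filter.Eventually.of_forall fun x => meas p x)
    (hB'.mono' (meas p x₀) (Filter.Eventually.of_forall fun y =>
      hB1' y x₀ (Metric.mem_ball_self one_pos))) (meas _ x₀)
    (Filter.Eventually.of_forall hB1) hB (Filter.Eventually.of_forall ?_)).2
  intro y x _
  exact ((aux_deriv p b (x - y)).comp_sub_const x y).const_mul (h y)

theorem aux_conv_int (h : ℝ → ℝ) (K : NNReal) (hL : LipschitzWith K h) (p : Polynomial ℝ)
    (b : ℝ) (hb : 0 < b) (x : ℝ) :
    Integrable (fun z => h (x - z) * (p.eval z * Real.exp (-b * z ^ 2))) := by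
  have hc := hL.continuous
  have i1 := ((aux_int p b hb).norm).const_mul |h x|
  have i2 := ((aux_int (Polynomial.X * p) b hb).norm).const_mul K
  refine (i1.add i2).mono' (by fun_prop : Continuous _).aestronglyMeasurable
    (Filter.Eventually.of_forall fun z => ?_)
  have hh : |h (x - z)| ≤ |h x| + K * |z| := by
    have := hL.dist_le_mul (x - z) x
    rw [Real.dist_eq, Real.dist_eq] at this
    have h3 := abs_sub_abs_le_abs_sub (h (x - z)) (h x)
    have : |x - z - x| = |z| := by rw [show x - z - x = -z by ring, abs_neg]
    simp_all
    linarith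
  rw [norm_mul, Real.norm_eq_abs (h _)]
  calc _ ≤ (|h x| + K * |z|) * ‖p.eval z * Real.exp (-b * z ^ 2)‖ := by gcongr
    _ = _ := by simp; ring

theorem aux_lip (h : ℝ → ℝ) (K : NNReal) (hL : LipschitzWith K h) :
    0 ≤ lipConst h ∧ LipschitzWith (lipConst h).toNNReal h := by
  have h0 : 0 ≤ lipConst h := by
    apply Real.sSup_nonneg
    rintro c ⟨x, y, _, rfl⟩
    positivity
  refine ⟨h0, LipschitzWith.of_dist_le_mul fun x y => ?_⟩
  rw [Real.coe_toNNReal _ h0]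
  by_cases hxy : x = y
  · subst hxy; simp
  have hpos : 0 < |x - y| := abs_pos.mpr (sub_ne_zero.mpr hxy)
  rw [Real.dist_eq, Real.dist_eq, ← div_le_iff₀ hpos]
  refine le_csSup ⟨K, ?_⟩ ⟨x, y, hxy, rfl⟩
  rintro c ⟨u, v, huv, rfl⟩
  rw [div_le_iff₀ (abs_pos.mpr (sub_ne_zero.mpr huv))]
  simpa [Real.dist_eq] using hL.dist_le_mul u v

theorem aux_convLip (h : ℝ → ℝ) (K : NNReal) (hL : LipschitzWith K h) (p : Polynomial ℝ)
    (b : ℝ) (hb : 0 < b) :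
    LipschitzWith (K * (∫ y, |p.eval y * Real.exp (-b * y ^ 2)|).toNNReal)
     (fun x => ∫ y, h y * (p.eval (x - y) * Real.exp (-b * (x - y) ^ 2))) := by
  have e : ∀ x, ∫ y, h y * (p.eval (x - y) * Real.exp (-b * (x - y) ^ 2)) =
      ∫ z, h (x - z) * (p.eval z * Real.exp (-b * z ^ 2)) := by
    intro x
    rw [← integral_sub_left_eq_self (fun y => h y * (p.eval (x - y) *
      Real.exp (-b * (x - y) ^ 2))) volume x]
    simp
  refine LipschitzWith.of_dist_le_mul fun x x' => ?_
  rw [e, e, Real.dist_eq, ← integral_sub (aux_conv_int h K hL p b hb x)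
    (aux_conv_int h K hL p b hb x'), NNReal.coe_mul,
    Real.coe_toNNReal _ (integral_nonneg fun _ => abs_nonneg _)]
  have hn := norm_integral_le_of_norm_le (f := fun z => h (x - z) * (p.eval z *
      Real.exp (-b * z ^ 2)) - h (x' - z) * (p.eval z * Real.exp (-b * z ^ 2)))
    (((aux_int p b hb).norm).const_mul (K * dist x x'))
    (Filter.Eventually.of_forall fun z => ?_)
  · refine hn.trans (le_of_eq ?_)
    rw [integral_const_mul]
    simp only [Real.norm_eq_abs]
    ring
  · rw [← sub_mul, norm_mul]
    gcongr
    have := hL.dist_le_mul (x - z) (x' - z)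
    rwa [dist_sub_right, dist_eq_norm] at this

noncomputable def gp (c b : ℝ) : ℕ → Polynomial ℝ
  | 0 => Polynomial.C c
  | n + 1 => (gp c b n).derivative - Polynomial.C (2 * b) * Polynomial.X * gp c b n

theorem aux_iter (c b : ℝ) (n : ℕ) :
    iteratedDeriv n (fun u => c * Real.exp (-b * u ^ 2)) =
      fun u => (gp c b n).eval u * Real.exp (-b * u ^ 2) := by
  induction n with
  | zero => simp [gp]
  | succ n ih =>
    rw [iteratedDeriv_succ, ih]
    funext u
    exact (aux_deriv _ b u).deriv

theorem aux_iter_conv (h : ℝ → ℝ) (K : NNReal) (hL : LipschitzWith K h) (c b : ℝ) (hb : 0 < b)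
    (n : ℕ) :
    iteratedDeriv n (fun x => ∫ y, h y * (c * Real.exp (-b * (x - y) ^ 2))) =
      fun x => ∫ y, h y * ((gp c b n).eval (x - y) * Real.exp (-b * (x - y) ^ 2)) := by
  induction n with
  | zero => simp [gp]
  | succ n ih =>
    rw [iteratedDeriv_succ, ih]
    funext u
    exact (aux_conv h K hL _ b hb u).deriv

noncomputable def hp (n : ℕ) : Polynomial ℝ := (Polynomial.hermite n).map (Int.castRingHom ℝ)

theorem hp_succ (n : ℕ) : hp (n + 1) = Polynomial.X * hp n - (hp n).derivative := by
  simp [hp, Polynomial.hermite_succ, Polynomial.derivative_map]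

theorem hp_der (n : ℕ) : (hp (n + 1)).derivative = (n + 1 : ℕ) * hp n := by
  induction n with
  | zero => simp [hp]
  | succ n ih =>
    rw [hp_succ (n + 1), Polynomial.derivative_sub, Polynomial.derivative_mul, ih,
      Polynomial.derivative_mul, hp_succ n]
    simp
    ring

theorem hp_eval (n : ℕ) (x : ℝ) :
    (Polynomial.aeval x (Polynomial.hermite n) : ℝ) = (hp n).eval x := by
  rw [hp, Polynomial.eval_map, Polynomial.aeval_def]; rfl

theorem gauss_one : ∫ x : ℝ, Real.exp (-(1 / 2) * x ^ 2) = Real.sqrt (2 * Real.pi) := by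
  rw [integral_gaussian]; congr 1; ring

theorem hp_norm (n : ℕ) : ∫ x : ℝ, (hp n * hp n).eval x * Real.exp (-(1 / 2) * x ^ 2) =
    n.factorial * Real.sqrt (2 * Real.pi) := by
  induction n with
  | zero => simpa [hp] using gauss_one
  | succ n ih =>
    have h1 : ∀ x : ℝ, HasDerivAt (fun u : ℝ => (hp (n + 1) * hp n).eval u *
        Real.exp (-(1 / 2) * u ^ 2))
        ((n + 1 : ℝ) * ((hp n * hp n).eval x * Real.exp (-(1 / 2) * x ^ 2)) -
          (hp (n + 1) * hp (n + 1)).eval x * Real.exp (-(1 / 2) * x ^ 2)) x := by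
      intro x
      convert aux_deriv (hp (n + 1) * hp n) (1 / 2) x using 1
      have e : (hp n).derivative = Polynomial.X * hp n - hp (n + 1) := by rw [hp_succ]; ring
      rw [Polynomial.derivative_mul, hp_der, e]
      simp
      ring
    have i1 := (aux_int (hp n * hp n) (1 / 2) (by norm_num)).const_mul (n + 1 : ℝ)
    have i2 := aux_int (hp (n + 1) * hp (n + 1)) (1 / 2) (by norm_num)
    have h2 := integral_eq_zero_of_hasDerivAt_of_integrable h1 (i1.sub i2)
      (aux_int _ (1 / 2) (by norm_num))
    rw [integral_sub i1 i2, integral_const_mul, ih] at h2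
    rw [Nat.factorial_succ]
    push_cast
    linarith

theorem hp_cs (n : ℕ) : (∫ x : ℝ, |(hp n).eval x| *
    (1 / Real.sqrt (2 * Real.pi) * Real.exp (-x ^ 2 / 2))) ^ 2 ≤ (n.factorial : ℝ) := by
  set s := Real.sqrt (2 * Real.pi) with hs
  have hs0 : 0 < s := by positivity
  have e : ∀ x : ℝ, |(hp n).eval x| * (1 / s * Real.exp (-x ^ 2 / 2)) =
      1 / s * |(hp n).eval x * Real.exp (-(1 / 2) * x ^ 2)| := by
    intro x
    rw [abs_mul, abs_of_pos (Real.exp_pos _), show -x ^ 2 / 2 = -(1 / 2) * x ^ 2 by ring]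
    ring
  simp_rw [e]
  rw [integral_const_mul]
  set J := ∫ x : ℝ, |(hp n).eval x * Real.exp (-(1 / 2) * x ^ 2)| with hJ
  have i0 := (integrable_exp_neg_mul_sq (b := 1 / 2) (by norm_num)).const_mul ((J / s) ^ 2)
  have i1 := ((aux_int (hp n) (1 / 2) (by norm_num)).norm).const_mul (2 * (J / s))
  have i2 := aux_int (hp n * hp n) (1 / 2) (by norm_num)
  have h0 : 0 ≤ ∫ x : ℝ, (((hp n * hp n).eval x * Real.exp (-(1 / 2) * x ^ 2) -
      2 * (J / s) * ‖(hp n).eval x * Real.exp (-(1 / 2) * x ^ 2)‖) +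
      (J / s) ^ 2 * Real.exp (-(1 / 2) * x ^ 2)) := by
    refine integral_nonneg fun x => ?_
    have : ((hp n * hp n).eval x * Real.exp (-(1 / 2) * x ^ 2) -
      2 * (J / s) * ‖(hp n).eval x * Real.exp (-(1 / 2) * x ^ 2)‖) +
      (J / s) ^ 2 * Real.exp (-(1 / 2) * x ^ 2) =
      (|(hp n).eval x| - J / s) ^ 2 * Real.exp (-(1 / 2) * x ^ 2) := by
      rw [norm_mul, Real.norm_eq_abs, Real.norm_eq_abs, abs_of_pos (Real.exp_pos _),
        Polynomial.eval_mul, sub_sq, sq_abs]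
      ring
    simp only [Pi.zero_apply]
    rw [this]
    positivity
  have i3 := i2.sub i1
  simp only [Pi.sub_def] at i3
  rw [integral_add i3 i0, integral_sub i2 i1, integral_const_mul, integral_const_mul,
    hp_norm, gauss_one, ← hs] at h0
  simp only [Real.norm_eq_abs] at h0
  rw [← hJ] at h0
  have h3 : (n.factorial : ℝ) * s - 2 * (J / s) * J + (J / s) ^ 2 * s =
      s * (n.factorial - (1 / s * J) ^ 2) := by field_simp; ring
  rw [h3] at h0
  have := nonneg_of_mul_nonneg_right h0 hs0
  linarith

theorem aux_scale (ρ : ℝ) (hρ : 0 < ρ) (n : ℕ) :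
    ∫ y, |iteratedDeriv n (fun x => ρ / Real.sqrt (2 * Real.pi) *
      Real.exp (-(x ^ 2 * ρ ^ 2) / 2)) y| =
    (∫ x : ℝ, |(hp n).eval x| *
      (1 / Real.sqrt (2 * Real.pi) * Real.exp (-x ^ 2 / 2))) * ρ ^ n := by
  have e1 : (fun x => ρ / Real.sqrt (2 * Real.pi) * Real.exp (-(x ^ 2 * ρ ^ 2) / 2)) =
      fun x => (fun y => ρ / Real.sqrt (2 * Real.pi) * Real.exp (-(y ^ 2 / 2))) (ρ * x) := by
    funext x
    simp only
    congr 2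
    ring
  have e2 : ∀ y, |iteratedDeriv n (fun x => ρ / Real.sqrt (2 * Real.pi) *
      Real.exp (-(x ^ 2 * ρ ^ 2) / 2)) y| = (fun x => ρ ^ n * ρ * (|(hp n).eval x| *
      (1 / Real.sqrt (2 * Real.pi) * Real.exp (-x ^ 2 / 2)))) (ρ * y) := by
    intro y
    rw [e1, iteratedDeriv_comp_const_mul
      (f := fun y => ρ / Real.sqrt (2 * Real.pi) * Real.exp (-(y ^ 2 / 2))) (by fun_prop)]
    simp only
    rw [iteratedDeriv_const_mul _ (by fun_prop), iteratedDeriv_eq_iterate,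
      Polynomial.deriv_gaussian_eq_hermite_mul_gaussian, hp_eval]
    simp only [abs_mul, abs_pow, abs_neg, abs_one, one_pow, abs_div, abs_of_pos hρ,
      abs_of_pos (Real.exp_pos _), abs_of_nonneg (Real.sqrt_nonneg _)]
    rw [neg_div]
    ring
  rw [integral_congr_ae (Filter.Eventually.of_forall e2)]
  rw [Measure.integral_comp_mul_left (fun x => ρ ^ n * ρ * (|(hp n).eval x| *
      (1 / Real.sqrt (2 * Real.pi) * Real.exp (-x ^ 2 / 2)))), integral_const_mul, abs_of_pos (by positivity), smul_eq_mul]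
  field_simp

theorem hp_C2 : ∫ x : ℝ, |(hp 1).eval x| *
    (1 / Real.sqrt (2 * Real.pi) * Real.exp (-x ^ 2 / 2)) = Real.sqrt (2 / Real.pi) := by
  have e : ∀ x : ℝ, |(hp 1).eval x| * (1 / Real.sqrt (2 * Real.pi) * Real.exp (-x ^ 2 / 2)) =
      (fun t => 1 / Real.sqrt (2 * Real.pi) * (t ^ (1 : ℝ) * Real.exp (-(1 / 2) * t ^ (2 : ℝ)))) |x| := by
    intro x
    simp only [Real.rpow_one, Real.rpow_two, sq_abs]
    rw [show -x ^ 2 / 2 = -(1 / 2) * x ^ 2 by ring]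
    simp [hp]
    ring
  simp_rw [e]
  rw [integral_comp_abs (f := fun t => 1 / Real.sqrt (2 * Real.pi) *
    (t ^ (1 : ℝ) * Real.exp (-(1 / 2) * t ^ (2 : ℝ)))), integral_const_mul,
    integral_rpow_mul_exp_neg_mul_rpow (by norm_num) (by norm_num) (by norm_num)]
  norm_num
  have h3 : Real.sqrt 2 ^ 2 = 2 := Real.sq_sqrt (by positivity)
  have h4 : 0 < Real.sqrt 2 := by positivity
  have h5 : 0 < Real.sqrt Real.pi := Real.sqrt_pos.mpr Real.pi_pos
  field_simp
  linarith

/-- Corollary `moll2`: fix `ρ > 0`, let `h : ℝ → ℝ` be Lipschitz with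
minimum Lipschitz constant `‖h'‖ = lipConst h`, let `k_ρ(x) = (ρ/√(2π)) e^{−x²ρ²/2}` and
`h_ρ = h ∗ k_ρ`.  Then for each `m ≥ 1`,
`sup_x |h_ρ^{(m)}(x)| ≤ ‖h'‖ ∫ |k_ρ^{(m−1)}| ≤ C_m ρ^{m−1} ‖h'‖`, where
`C_m = ∫ |H_{m−1}(x)| φ(x) dx` with `φ` the standard normal density and `H_j` the `j`-th monic
(probabilists') Hermite polynomial; moreover `C₁ = 1`, `C₂ = √(2/π)` and `C_m² ≤ (m−1)!` for
`m ≥ 3`. -/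
theorem mollified_derivative_bounds
    (ρ : ℝ) (hρ : 0 < ρ)
    (h : ℝ → ℝ) (hLip : ∃ K : NNReal, LipschitzWith K h)
    (k : ℝ → ℝ) (hk : k = fun x => ρ / Real.sqrt (2 * Real.pi) * Real.exp (-(x ^ 2 * ρ ^ 2) / 2))
    (hmoll : ℝ → ℝ) (hhmoll : hmoll = fun x => ∫ y, h y * k (x - y))
    (C : ℕ → ℝ)
    (hC : ∀ m, C m = ∫ x, |(Polynomial.aeval x (Polynomial.hermite (m - 1)) : ℝ)| *
      (1 / Real.sqrt (2 * Real.pi) * Real.exp (-x ^ 2 / 2))) :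
    (∀ m : ℕ, 1 ≤ m →
      (∀ x : ℝ, |iteratedDeriv m hmoll x|
          ≤ lipConst h * ∫ y, |iteratedDeriv (m - 1) k y|) ∧
      lipConst h * (∫ y, |iteratedDeriv (m - 1) k y|)
          ≤ C m * ρ ^ (m - 1) * lipConst h) ∧
    C 1 = 1 ∧ C 2 = Real.sqrt (2 / Real.pi) ∧
    ∀ m : ℕ, 3 ≤ m → (C m) ^ 2 ≤ (Nat.factorial (m - 1) : ℝ) := by
  obtain ⟨K, hK⟩ := hLip
  obtain ⟨hl0, hl⟩ := aux_lip h K hK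
  have hk' : k = fun u => ρ / Real.sqrt (2 * Real.pi) * Real.exp (-(ρ ^ 2 / 2) * u ^ 2) := by
    rw [hk]; funext u; congr 2; ring
  have hb : 0 < ρ ^ 2 / 2 := by positivity
  have hC' : ∀ n, C (n + 1) = ∫ x : ℝ, |(hp n).eval x| *
      (1 / Real.sqrt (2 * Real.pi) * Real.exp (-x ^ 2 / 2)) := by
    intro n
    rw [hC]
    simp only [Nat.add_sub_cancel, hp_eval]
  refine ⟨?_, ?_, ?_, ?_⟩
  · intro m hm
    obtain ⟨n, rfl⟩ : ∃ n, m = n + 1 := ⟨m - 1, by omega⟩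
    rw [Nat.add_sub_cancel]
    constructor
    · intro x
      have h1 := norm_deriv_le_of_lipschitz (x₀ := x) (aux_convLip h _ hl
        (gp (ρ / Real.sqrt (2 * Real.pi)) (ρ ^ 2 / 2) n) _ hb)
      rw [← aux_iter_conv h _ hl _ _ hb, ← iteratedDeriv_succ, NNReal.coe_mul,
        Real.coe_toNNReal _ (integral_nonneg fun _ => abs_nonneg _),
        Real.coe_toNNReal _ hl0] at h1
      rw [hhmoll, hk', aux_iter]
      exact h1
    · rw [hC', hk, aux_scale ρ hρ n]
      exact le_of_eq (mul_comm _ _)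
  · rw [hC' 0]
    have : ∀ x : ℝ, |(hp 0).eval x| * (1 / Real.sqrt (2 * Real.pi) * Real.exp (-x ^ 2 / 2)) =
        1 / Real.sqrt (2 * Real.pi) * Real.exp (-(1 / 2) * x ^ 2) := by
      intro x
      rw [show -x ^ 2 / 2 = -(1 / 2) * x ^ 2 by ring]
      simp [hp]
    simp_rw [this]
    rw [integral_const_mul, gauss_one]
    have : 0 < Real.sqrt (2 * Real.pi) := by positivity
    field_simp
  · rw [hC' 1]; exact hp_C2
  · intro m hm
    obtain ⟨n, rfl⟩ : ∃ n, m = n + 1 := ⟨m - 1, by omega⟩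
    rw [Nat.add_sub_cancel, hC']
    exact hp_cs n
end

section
/- Let r > 0 and let F_r denote the distribution function of the Gamma distribution with shape parameter r and rate 1. Define N(x) := x·F_r(x) − (1 + r − x)·∫₀ˣ F_r(t) dt for x ≥ 0. Then N'(x) = 2∫₀ˣ F_r(t) dt ≥ 0 for all x > 0, and consequently N(x) ≥ 0 for all x ≥ 0. -/
open MeasureTheory ProbabilityTheory Real

/-- monotonicity of `N` in the proof of Theorem `bounds1`: let `r > 0`, let
`F_r(x) = ∫₀ˣ p_r(t) dt` be the distribution function of the `Γ(r,1)` distribution (with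
density `p_r = gammaPDFReal r 1`), and let
`N(x) = x F_r(x) − (1 + r − x) ∫₀ˣ F_r(t) dt`.  Then for every `x > 0`, `N` has derivative
`N'(x) = 2 ∫₀ˣ F_r(t) dt ≥ 0` at `x`, and `N(x) ≥ 0` for every `x ≥ 0`. -/
theorem gamma_cdf_N_nonneg
    (r : ℝ) (hr : 0 < r)
    (Fr : ℝ → ℝ) (hFr : ∀ x : ℝ, Fr x = ∫ t in (0:ℝ)..x, gammaPDFReal r 1 t)
    (N : ℝ → ℝ)
    (hN : ∀ x : ℝ, N x = x * Fr x - (1 + r - x) * ∫ t in (0:ℝ)..x, Fr t) :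
    (∀ x : ℝ, 0 < x →
      HasDerivAt N (2 * ∫ t in (0:ℝ)..x, Fr t) x ∧
        0 ≤ 2 * ∫ t in (0:ℝ)..x, Fr t) ∧
    ∀ x : ℝ, 0 ≤ x → 0 ≤ N x := by
  have hFr' : Fr = fun x => ∫ t in (0:ℝ)..x, gammaPDFReal r 1 t := funext hFr
  have hN' : N = fun x => x * Fr x - (1 + r - x) * ∫ t in (0:ℝ)..x, Fr t := funext hN
  have hint : Integrable (gammaPDFReal r 1) := by
    refine ⟨(measurable_gammaPDFReal r 1).aestronglyMeasurable, ?_⟩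
    rw [hasFiniteIntegral_iff_ofReal (Filter.Eventually.of_forall fun x =>
      gammaPDFReal_nonneg hr one_pos x)]
    have := lintegral_gammaPDF_eq_one hr one_pos
    simp only [gammaPDF] at this
    rw [this]; exact ENNReal.one_lt_top
  have hFc : Continuous Fr := by
    rw [hFr']
    exact intervalIntegral.continuous_primitive (fun a b => hint.intervalIntegrable) 0
  have hp : ∀ x : ℝ, 0 < x → gammaPDFReal r 1 x = x ^ (r - 1) * exp (-x) / Gamma r := by
    intro x hx
    simp only [gammaPDFReal, hx.le, if_true, one_rpow, one_mul]
    ring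
  have hFd : ∀ x : ℝ, 0 < x → HasDerivAt Fr (gammaPDFReal r 1 x) x := by
    intro x hx
    rw [hFr']
    refine intervalIntegral.integral_hasDerivAt_right hint.intervalIntegrable
      (measurable_gammaPDFReal r 1).stronglyMeasurable.stronglyMeasurableAtFilter ?_
    have : ContinuousAt (fun x : ℝ => x ^ (r - 1) * exp (-x) / Gamma r) x := by
      have := continuousAt_rpow_const x (r - 1) (Or.inl hx.ne')
      fun_prop
    refine this.congr ?_
    filter_upwards [lt_mem_nhds hx] with y hy using (hp y hy).symm
  have hId : ∀ x : ℝ, HasDerivAt (fun x => ∫ t in (0:ℝ)..x, Fr t) (Fr x) x := fun x =>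
    intervalIntegral.integral_hasDerivAt_right (hFc.intervalIntegrable _ _)
      (hFc.stronglyMeasurableAtFilter _ _) hFc.continuousAt
  have hIc : Continuous (fun x => ∫ t in (0:ℝ)..x, Fr t) :=
    continuous_iff_continuousAt.2 fun x => (hId x).continuousAt
  have hF0 : ∀ x : ℝ, 0 ≤ x → 0 ≤ Fr x := by
    intro x hx
    rw [hFr]
    exact intervalIntegral.integral_nonneg hx fun u _ => gammaPDFReal_nonneg hr one_pos u
  have hI0 : ∀ x : ℝ, 0 ≤ x → 0 ≤ ∫ t in (0:ℝ)..x, Fr t := fun x hx =>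
    intervalIntegral.integral_nonneg hx fun u hu => hF0 u hu.1
  have key : ∀ x : ℝ, 0 < x →
      x ^ r * exp (-x) / Gamma r + (x - r) * Fr x - (∫ t in (0:ℝ)..x, Fr t) = 0 := by
    intro x hx
    have hqc : Continuous (fun x : ℝ => x ^ r) := continuous_id.rpow_const fun _ => Or.inr hr.le
    have hd : ∀ y : ℝ, 0 < y → HasDerivAt (fun x : ℝ => x ^ r * exp (-x) / Gamma r
        + (x - r) * Fr x - (∫ t in (0:ℝ)..x, Fr t)) 0 y := by
      intro y hy
      have h1 := hasDerivAt_rpow_const (x := y) (p := r) (Or.inl hy.ne')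
      have h2 : HasDerivAt (fun x : ℝ => exp (-x)) (exp (-y) * (-1)) y :=
        (hasDerivAt_neg y).exp
      have h3 := (((h1.mul h2).div_const (Gamma r)).add
        (((hasDerivAt_id y).sub_const r).mul (hFd y hy))).sub (hId y)
      refine h3.congr_deriv ?_
      have h4 : y ^ r = y ^ (r - 1) * y := by
        rw [← rpow_add_one hy.ne']; simp
      rw [hp y hy, h4]
      simp only [id]
      ring
    obtain ⟨c, hc, hc'⟩ := exists_hasDerivAt_eq_slope (fun x : ℝ => x ^ r * exp (-x) / Gamma r
        + (x - r) * Fr x - (∫ t in (0:ℝ)..x, Fr t)) (fun _ => 0) hx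
        (by apply Continuous.continuousOn; fun_prop) (fun y hy => hd y hy.1)
    have h00 : Fr 0 = 0 := by rw [hFr]; simp
    rw [eq_comm, div_eq_zero_iff] at hc'
    rcases hc' with h | h
    · simpa [h00, zero_rpow hr.ne'] using h
    · linarith
  have hNd : ∀ x : ℝ, 0 < x → HasDerivAt N (2 * ∫ t in (0:ℝ)..x, Fr t) x := by
    intro x hx
    rw [hN']
    have h3 := ((hasDerivAt_id x).mul (hFd x hx)).sub
      (((hasDerivAt_id x).const_sub (1 + r)).mul (hId x))
    refine h3.congr_deriv ?_
    have h4 : x ^ r = x ^ (r - 1) * x := by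
      rw [← rpow_add_one hx.ne']; simp
    have := key x hx
    rw [h4] at this
    rw [hp x hx]
    simp only [id]
    linear_combination this
  refine ⟨fun x hx => ⟨hNd x hx, mul_nonneg zero_le_two (hI0 x hx.le)⟩, fun x hx => ?_⟩
  have hmono : MonotoneOn N (Set.Ici 0) := by
    refine monotoneOn_of_deriv_nonneg (convex_Ici 0) ?_ ?_ ?_
    · rw [hN']; apply Continuous.continuousOn; fun_prop
    · intro y hy
      rw [interior_Ici] at hy
      exact (hNd y hy).differentiableAt.differentiableWithinAt
    · intro y hy
      rw [interior_Ici] at hy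
      rw [(hNd y hy).deriv]
      exact mul_nonneg zero_le_two (hI0 y (le_of_lt hy))
  have := hmono (Set.mem_Ici.2 le_rfl) (Set.mem_Ici.2 hx) hx
  rw [hN 0] at this
  simpa using this
end
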